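/- arXiv:2512.13537 — 2 statements merged into one kernel-verified Lean document; each statement's English description precedes it below -/
import Mathlib

section
/- Let x̃ ∈ ℝ^d and set w_k = f(x_k) − f(x̃). Suppose for all k ≥ N_1: x_{k+1} = x_k − η_k ∇f(x_k) with 0 < η_k ≤ 1/L, w_k ≥ 0, and the KL inequality ‖∇f(x_k)‖^2 ≥ 2μ w_k^α holds with μ > 0 and α ∈ (0,2). Then the trajectory has finite length beyond N_1: ∑_{k=N_1}^∞ ‖x_{k+1} − x_k‖ ≤ √(2/μ) · (2/(2−α)) · w_{N_1}^{(2−α)/2}; in particular (x_k) is a Cauchy sequence and converges. -/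
/-- The descent lemma for functions with `L`-Lipschitz gradient on a real Hilbert space. -/
theorem le_add_inner_add_sq_of_lipschitz_gradient
    {E : Type*} [NormedAddCommGroup E] [InnerProductSpace ℝ E] [CompleteSpace E]
    {f : E → ℝ} (hf : Differentiable ℝ f) {L : ℝ}
    (hLip : ∀ y z, ‖gradient f y - gradient f z‖ ≤ L * ‖y - z‖) (x v : E) :
    f (x + v) ≤ f x + inner ℝ (gradient f x) v + L / 2 * ‖v‖ ^ 2 := by
  have hderiv : ∀ t : ℝ, HasDerivAt
      (fun t : ℝ => f (x + t • v) - t * inner ℝ (gradient f x) v - L / 2 * ‖v‖ ^ 2 * t ^ 2)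
      (inner ℝ (gradient f (x + t • v)) v - inner ℝ (gradient f x) v - L * ‖v‖ ^ 2 * t) t := by
    intro t
    have hline : HasDerivAt (fun t : ℝ => x + t • v) v t := by
      simpa using ((hasDerivAt_id t).smul_const v).const_add x
    have hcomp := (hf (x + t • v)).hasGradientAt.hasFDerivAt.comp_hasDerivAt t hline
    have hlin : HasDerivAt (fun t : ℝ => t * inner ℝ (gradient f x) v)
        (inner ℝ (gradient f x) v) t := by
      simpa using (hasDerivAt_id t).mul_const (inner ℝ (gradient f x) v)
    have hquad : HasDerivAt (fun t : ℝ => L / 2 * ‖v‖ ^ 2 * t ^ 2) (L * ‖v‖ ^ 2 * t) t := by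
      refine ((hasDerivAt_pow 2 t).const_mul (L / 2 * ‖v‖ ^ 2)).congr_deriv ?_
      push_cast
      ring
    exact (hcomp.sub hlin).sub hquad
  have hanti := antitoneOn_of_deriv_nonpos (convex_Icc (0 : ℝ) 1)
    (fun t _ => (hderiv t).continuousAt.continuousWithinAt)
    (fun t _ => (hderiv t).differentiableAt.differentiableWithinAt) (by
      intro t ht
      rw [interior_Icc] at ht
      rw [(hderiv t).deriv, ← inner_sub_left]
      have hnorm := hLip (x + t • v) x
      rw [add_sub_cancel_left, norm_smul, Real.norm_of_nonneg ht.1.le] at hnorm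
      nlinarith [real_inner_le_norm (gradient f (x + t • v) - gradient f x) v,
        mul_le_mul_of_nonneg_right hnorm (norm_nonneg v)])
  have := hanti (Set.left_mem_Icc.2 zero_le_one) (Set.right_mem_Icc.2 zero_le_one) zero_le_one
  simp only [one_smul, zero_smul, add_zero, one_mul, zero_mul, one_pow, mul_one, sub_zero,
    ne_eq, OfNat.ofNat_ne_zero, not_false_eq_true, zero_pow, mul_zero] at this
  linarith

/-- A gradient step of size at most `1 / L` decreases `f` by at least `η / 2 * ‖∇f x‖ ^ 2`. -/
theorem gradient_step_le
    {E : Type*} [NormedAddCommGroup E] [InnerProductSpace ℝ E] [CompleteSpace E]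
    {f : E → ℝ} (hf : Differentiable ℝ f) {L : ℝ} (hL : 0 < L)
    (hLip : ∀ y z, ‖gradient f y - gradient f z‖ ≤ L * ‖y - z‖) (x : E)
    {η : ℝ} (hη : 0 ≤ η) (hηL : η ≤ 1 / L) :
    f (x - η • gradient f x) ≤ f x - η / 2 * ‖gradient f x‖ ^ 2 := by
  have h := le_add_inner_add_sq_of_lipschitz_gradient hf hLip x (-(η • gradient f x))
  rw [← sub_eq_add_neg, inner_neg_right, real_inner_smul_right, real_inner_self_eq_norm_sq,
    norm_neg, norm_smul, Real.norm_of_nonneg hη] at h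
  rw [le_div_iff₀ hL] at hηL
  nlinarith [mul_nonneg (mul_nonneg hη (sub_nonneg.2 hηL)) (sq_nonneg ‖gradient f x‖)]

/-- The tangent-line bound for the concave power `w ↦ w ^ θ`, with `θ ∈ [0, 1]`. -/
theorem Real.mul_rpow_sub_one_mul_sub_le_rpow_sub_rpow {θ a b : ℝ} (hθ0 : 0 ≤ θ) (hθ1 : θ ≤ 1)
    (ha : 0 < a) (hb : 0 ≤ b) : θ * a ^ (θ - 1) * (a - b) ≤ a ^ θ - b ^ θ := by
  have hbern := rpow_one_add_le_one_add_mul_self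
    (by linarith [div_nonneg hb ha.le] : -1 ≤ b / a - 1) hθ0 hθ1
  rw [add_sub_cancel, Real.div_rpow hb ha.le, div_le_iff₀ (by positivity)] at hbern
  have hpow : a ^ θ = a ^ (θ - 1) * a := by
    rw [Real.rpow_sub_one ha.ne', div_mul_cancel₀ _ ha.ne']
  have hexp : (1 + θ * (b / a - 1)) * a ^ θ = a ^ θ - θ * a ^ (θ - 1) * (a - b) := by
    rw [hpow]
    field_simp
    ring
  linarith

/-- If a descent step from value `w` to `w'` has `w' ≤ w - η / 2 * g ^ 2` and the KL inequality
`2 * μ * w ^ α ≤ g ^ 2` holds, then the step length `η * g` is controlled by the decrease of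
the desingularized values `w ^ ((2 - α) / 2)`. -/
theorem step_length_le_of_KL {μ α η g w w' : ℝ} (hμ : 0 < μ) (hα : α ∈ Set.Ioo (0 : ℝ) 2)
    (hη : 0 < η) (hg : 0 ≤ g) (hw : 0 ≤ w) (hw' : 0 ≤ w') (hdec : w' ≤ w - η / 2 * g ^ 2)
    (hKL : 2 * μ * w ^ α ≤ g ^ 2) :
    η * g ≤ Real.sqrt (2 / μ) * (2 / (2 - α)) * (w ^ ((2 - α) / 2) - w' ^ ((2 - α) / 2)) := by
  obtain ⟨hα0, hα2⟩ := hα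
  have hα' : 0 < 2 - α := by linarith
  rcases hw.eq_or_lt with rfl | hwpos
  · have hg0 : g = 0 := by
      by_contra hne
      have : 0 < η / 2 * g ^ 2 := by positivity
      linarith
    subst hg0
    have hw0 : w' = 0 := by linarith
    simp [hw0]
  · have htan := Real.mul_rpow_sub_one_mul_sub_le_rpow_sub_rpow
      (θ := (2 - α) / 2) (by linarith) (by linarith) hwpos hw'
    set D := w ^ ((2 - α) / 2) - w' ^ ((2 - α) / 2)
    set p := w ^ (α / 2)
    have hp : 0 < p := Real.rpow_pos_of_pos hwpos _
    have hpow : w ^ ((2 - α) / 2 - 1) = p⁻¹ := by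
      rw [← Real.rpow_neg hw]
      congr 1
      ring
    have hpsq : w ^ α = p ^ 2 := by
      rw [← Real.rpow_mul_natCast hw]
      congr 1
      push_cast
      ring
    set s := Real.sqrt (2 / μ)
    have hs : 0 < s := Real.sqrt_pos.2 (by positivity)
    have hs2 : s ^ 2 * μ = 2 := by
      rw [Real.sq_sqrt (by positivity), div_mul_cancel₀ _ hμ.ne']
    have hpg : 2 * p ≤ s * g := by
      refine (pow_le_pow_iff_left₀ (by positivity) (by positivity) two_ne_zero).1 ?_
      rw [hpsq] at hKL
      nlinarith [mul_le_mul_of_nonneg_left hKL (sq_nonneg s)]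
    rw [hpow] at htan
    have hlen : η * g ≤ s * (p⁻¹ * (w - w')) := by
      have : s * (p⁻¹ * (w - w')) = s * (w - w') / p := by field_simp
      rw [this, le_div_iff₀ hp]
      nlinarith [mul_le_mul_of_nonneg_left hpg (mul_nonneg hη.le hg),
        mul_le_mul_of_nonneg_left hdec hs.le]
    refine hlen.trans ?_
    rw [mul_assoc]
    refine mul_le_mul_of_nonneg_left ?_ hs.le
    rw [div_mul_eq_mul_div, le_div_iff₀ hα']
    linarith

/-- A nonnegative sequence dominated by the increments of a nonnegative sequence is summable,
with sum at most the initial value. -/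
theorem summable_and_tsum_le_of_le_sub_succ {u v : ℕ → ℝ} (hu : ∀ k, 0 ≤ u k) (hv : ∀ k, 0 ≤ v k)
    (h : ∀ k, u k ≤ v k - v (k + 1)) : Summable u ∧ ∑' k, u k ≤ v 0 := by
  have hpartial : ∀ n, ∑ k ∈ Finset.range n, u k ≤ v 0 := fun n =>
    calc ∑ k ∈ Finset.range n, u k ≤ ∑ k ∈ Finset.range n, (v k - v (k + 1)) :=
          Finset.sum_le_sum fun k _ => h k
      _ = v 0 - v n := Finset.sum_range_sub' v n
      _ ≤ v 0 := sub_le_self _ (hv n)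
  exact ⟨summable_of_sum_range_le hu hpartial, Real.tsum_le_of_sum_range_le hu hpartial⟩

/-- Finite length under the KL inequality: if for all `k ≥ N₁` the gradient step has
step size `0 < η_k ≤ 1/L`, `w_k = f(x_k) − f(x̃) ≥ 0` and `‖∇f(x_k)‖^2 ≥ 2μ w_k^α`
with `α ∈ (0,2)`, then `∑_{k=N₁}^∞ ‖x_{k+1} − x_k‖ ≤ √(2/μ)·(2/(2−α))·w_{N₁}^{(2−α)/2}`;
in particular `(x_k)` is Cauchy and converges. -/
theorem KL_finite_length
    {d : ℕ} (hd : 1 ≤ d)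
    (f : EuclideanSpace ℝ (Fin d) → ℝ) (hf : Differentiable ℝ f)
    (L : ℝ) (hL : 0 < L)
    (hLip : ∀ y z, ‖gradient f y - gradient f z‖ ≤ L * ‖y - z‖)
    (x : ℕ → EuclideanSpace ℝ (Fin d)) (η : ℕ → ℝ) (N₁ : ℕ)
    (xt : EuclideanSpace ℝ (Fin d))
    (μ α : ℝ) (hμ : 0 < μ) (hα : α ∈ Set.Ioo (0 : ℝ) 2)
    (hstep : ∀ k : ℕ, N₁ ≤ k → x (k + 1) = x k - η k • gradient f (x k))
    (hηpos : ∀ k : ℕ, N₁ ≤ k → 0 < η k)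
    (hηup : ∀ k : ℕ, N₁ ≤ k → η k ≤ 1 / L)
    (hw : ∀ k : ℕ, N₁ ≤ k → 0 ≤ f (x k) - f xt)
    (hKL : ∀ k : ℕ, N₁ ≤ k → 2 * μ * (f (x k) - f xt) ^ α ≤ ‖gradient f (x k)‖ ^ 2) :
    (∑' k : ℕ, ‖x (N₁ + k + 1) - x (N₁ + k)‖) ≤
      Real.sqrt (2 / μ) * (2 / (2 - α)) * (f (x N₁) - f xt) ^ ((2 - α) / 2) ∧
    CauchySeq x ∧ ∃ p, Filter.Tendsto x Filter.atTop (nhds p) := by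
  have hα' : 0 < 2 - α := by linarith [hα.2]
  have hlen : ∀ k, ‖x (N₁ + k + 1) - x (N₁ + k)‖ ≤
      Real.sqrt (2 / μ) * (2 / (2 - α)) * (f (x (N₁ + k)) - f xt) ^ ((2 - α) / 2) -
      Real.sqrt (2 / μ) * (2 / (2 - α)) * (f (x (N₁ + (k + 1))) - f xt) ^ ((2 - α) / 2) := by
    intro k
    have hk : N₁ ≤ N₁ + k := Nat.le_add_right _ _
    have hdec := gradient_step_le hf hL hLip (x (N₁ + k)) (hηpos _ hk).le (hηup _ hk)
    rw [← hstep _ hk] at hdec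
    have hnorm : ‖x (N₁ + k + 1) - x (N₁ + k)‖ = η (N₁ + k) * ‖gradient f (x (N₁ + k))‖ := by
      rw [hstep _ hk, sub_sub_cancel_left, norm_neg, norm_smul,
        Real.norm_of_nonneg (hηpos _ hk).le]
    rw [hnorm, ← mul_sub, ← add_assoc]
    exact step_length_le_of_KL hμ hα (hηpos _ hk) (norm_nonneg _) (hw _ hk)
      (hw _ (hk.trans (Nat.le_succ _))) (by linarith) (hKL _ hk)
  obtain ⟨hsum, hle⟩ := summable_and_tsum_le_of_le_sub_succ (fun _ => norm_nonneg _)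
    (v := fun k => Real.sqrt (2 / μ) * (2 / (2 - α)) *
      (f (x (N₁ + k)) - f xt) ^ ((2 - α) / 2))
    (fun k => mul_nonneg (by positivity)
      (Real.rpow_nonneg (hw _ (Nat.le_add_right _ _)) _)) hlen
  have hcauchy : CauchySeq x := by
    refine cauchySeq_of_summable_dist ((summable_nat_add_iff N₁).1 ?_)
    refine hsum.congr fun k => ?_
    rw [dist_comm, dist_eq_norm, Nat.succ_eq_add_one, add_comm k N₁]
  exact ⟨hle, hcauchy, cauchySeq_tendsto_of_complete hcauchy⟩
end

section
/- (Polynomial rate, KL exponent α ∈ (1,2).) Let x̃ ∈ ℝ^d and set w_k = f(x_k) − f(x̃). Suppose α ∈ (1,2), and for all k ≥ N_1: x_{k+1} = x_k − η_k ∇f(x_k) with a ≤ η_k ≤ 1/L for some a > 0, w_k > 0, and ‖∇f(x_k)‖^2 ≥ 2μ w_k^α with μ > 0; suppose also x_k → x̃ as k → ∞. Set Q = a μ. Then for all k ≥ N_1, ‖x_k − x̃‖ ≤ √(2/μ) · (2/(2−α)) · [ w_{N_1}^{1−α} + (α−1)(k−N_1) Q ]^{−(2−α)/(2(α−1))}.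 -/
/-- The descent lemma for functions with Lipschitz gradient. -/
lemma le_add_inner_gradient_add_norm_sq_of_lipschitz
    {E : Type*} [NormedAddCommGroup E] [InnerProductSpace ℝ E] [CompleteSpace E]
    {f : E → ℝ} (hf : Differentiable ℝ f) {L : ℝ}
    (hLip : ∀ y z, ‖gradient f y - gradient f z‖ ≤ L * ‖y - z‖) (y v : E) :
    f (y + v) ≤ f y + inner ℝ (gradient f y) v + L / 2 * ‖v‖ ^ 2 := by
  have hderiv (t : ℝ) : HasDerivAt
      (fun t : ℝ => f (y + t • v) - t * inner ℝ (gradient f y) v - L / 2 * ‖v‖ ^ 2 * t ^ 2)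
      (inner ℝ (gradient f (y + t • v) - gradient f y) v - L * t * ‖v‖ ^ 2) t := by
    have hline : HasDerivAt (fun t : ℝ => y + t • v) v t := by
      simpa using ((hasDerivAt_id t).smul_const v).const_add y
    have hcomp := (hf (y + t • v)).hasGradientAt.hasFDerivAt.comp_hasDerivAt t hline
    refine ((hcomp.sub ((hasDerivAt_id t).mul_const (inner ℝ (gradient f y) v))).sub
      ((hasDerivAt_pow 2 t).const_mul (L / 2 * ‖v‖ ^ 2))).congr_deriv ?_
    rw [InnerProductSpace.toDual_apply_apply, inner_sub_left]
    push_cast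
    ring
  have hanti := antitoneOn_of_deriv_nonpos (convex_Icc (0 : ℝ) 1)
    (fun t _ => (hderiv t).continuousAt.continuousWithinAt)
    (fun t _ => (hderiv t).differentiableAt.differentiableWithinAt) (fun t ht => by
      rw [interior_Icc] at ht
      rw [(hderiv t).deriv]
      have hinner := real_inner_le_norm (gradient f (y + t • v) - gradient f y) v
      have hnorm : ‖gradient f (y + t • v) - gradient f y‖ ≤ L * (t * ‖v‖) := by
        simpa [norm_smul, abs_of_pos ht.1] using hLip (y + t • v) y
      nlinarith [mul_le_mul_of_nonneg_right hnorm (norm_nonneg v)])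
  have := hanti (Set.left_mem_Icc.2 zero_le_one) (Set.right_mem_Icc.2 zero_le_one) zero_le_one
  simp only [one_smul, zero_smul, add_zero] at this
  linarith

/-- A gradient step of length at most `1 / L` decreases the function. -/
lemma gradient_step_decrease
    {E : Type*} [NormedAddCommGroup E] [InnerProductSpace ℝ E] [CompleteSpace E]
    {f : E → ℝ} (hf : Differentiable ℝ f) {L η : ℝ} (hL : 0 < L)
    (hLip : ∀ y z, ‖gradient f y - gradient f z‖ ≤ L * ‖y - z‖)
    (hη : 0 ≤ η) (hηL : η ≤ 1 / L) (y : E) :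
    η / 2 * ‖gradient f y‖ ^ 2 ≤ f y - f (y - η • gradient f y) := by
  have h := le_add_inner_gradient_add_norm_sq_of_lipschitz hf hLip y (-(η • gradient f y))
  rw [← sub_eq_add_neg, inner_neg_right, real_inner_smul_right, real_inner_self_eq_norm_sq,
    norm_neg, norm_smul, Real.norm_of_nonneg hη] at h
  have hLη : η * L ≤ 1 := (le_div_iff₀ hL).1 hηL
  nlinarith [mul_le_mul_of_nonneg_right hLη (mul_nonneg hη (sq_nonneg ‖gradient f y‖))]

/-- Tangent-line bound for the convex function `t ↦ t ^ (-p)`, `p ≥ 0`. -/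
lemma rpow_neg_tangent_le {p u v : ℝ} (hp : 0 ≤ p) (hu : 0 < u) (hv : 0 < v) :
    p * u ^ (-p - 1) * (u - v) ≤ v ^ (-p) - u ^ (-p) := by
  have hlog := Real.log_le_sub_one_of_pos (div_pos hv hu)
  have hexp := Real.add_one_le_exp (Real.log (v / u) * -p)
  rw [← Real.rpow_def_of_pos (div_pos hv hu), Real.div_rpow hv.le hu.le] at hexp
  have hbern : 1 + p * ((u - v) / u) ≤ v ^ (-p) / u ^ (-p) := by
    have : (u - v) / u = 1 - v / u := by field_simp
    nlinarith [mul_le_mul_of_nonneg_left hlog hp]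
  rw [le_div_iff₀ (Real.rpow_pos_of_pos hu _)] at hbern
  rw [Real.rpow_sub_one hu.ne']
  calc _ = (1 + p * ((u - v) / u)) * u ^ (-p) - u ^ (-p) := by ring
    _ ≤ _ := by linarith

/-- Tangent-line bound for the concave function `t ↦ t ^ s`, `0 ≤ s ≤ 1`. -/
lemma rpow_tangent_le {s u v : ℝ} (hs : 0 ≤ s) (hs' : s ≤ 1) (hu : 0 < u) (hv : 0 ≤ v) :
    s * u ^ (s - 1) * (u - v) ≤ u ^ s - v ^ s := by
  have hbern := rpow_one_add_le_one_add_mul_self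
    (s := v / u - 1) (by linarith [div_nonneg hv hu.le]) hs hs'
  rw [add_sub_cancel, Real.div_rpow hv hu.le, div_le_iff₀ (Real.rpow_pos_of_pos hu _)] at hbern
  rw [Real.rpow_sub_one hu.ne']
  calc _ = u ^ s - (1 + s * (v / u - 1)) * u ^ s := by field_simp; ring
    _ ≤ _ := by linarith

/-- Polynomial rate under the KL condition with exponent `α ∈ (1,2)`: with `Q = aμ`,
`‖x_k − x̃‖ ≤ √(2/μ)·(2/(2−α))·[w_{N₁}^{1−α} + (α−1)(k−N₁)Q]^{−(2−α)/(2(α−1))}`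
for all `k ≥ N₁`. -/
theorem KL_polynomial_rate
    {d : ℕ} (hd : 1 ≤ d)
    (f : EuclideanSpace ℝ (Fin d) → ℝ) (hf : Differentiable ℝ f)
    (L : ℝ) (hL : 0 < L)
    (hLip : ∀ y z, ‖gradient f y - gradient f z‖ ≤ L * ‖y - z‖)
    (x : ℕ → EuclideanSpace ℝ (Fin d)) (η : ℕ → ℝ) (N₁ : ℕ)
    (xt : EuclideanSpace ℝ (Fin d))
    (a μ α : ℝ) (ha : 0 < a) (hμ : 0 < μ) (hα : α ∈ Set.Ioo (1 : ℝ) 2)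
    (hstep : ∀ k : ℕ, N₁ ≤ k → x (k + 1) = x k - η k • gradient f (x k))
    (hηlow : ∀ k : ℕ, N₁ ≤ k → a ≤ η k)
    (hηup : ∀ k : ℕ, N₁ ≤ k → η k ≤ 1 / L)
    (hw : ∀ k : ℕ, N₁ ≤ k → 0 < f (x k) - f xt)
    (hKL : ∀ k : ℕ, N₁ ≤ k → 2 * μ * (f (x k) - f xt) ^ α ≤ ‖gradient f (x k)‖ ^ 2)
    (hlim : Filter.Tendsto x Filter.atTop (nhds xt)) :
    ∀ k : ℕ, N₁ ≤ k →
      ‖x k - xt‖ ≤ Real.sqrt (2 / μ) * (2 / (2 - α))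
        * ((f (x N₁) - f xt) ^ (1 - α) + (α - 1) * ((k : ℝ) - (N₁ : ℝ)) * (a * μ))
          ^ (-(2 - α) / (2 * (α - 1))) := by
  obtain ⟨hα₁, hα₂⟩ := hα
  have hdecr (k : ℕ) (hk : N₁ ≤ k) :
      η k / 2 * ‖gradient f (x k)‖ ^ 2 ≤ (f (x k) - f xt) - (f (x (k + 1)) - f xt) := by
    have h := gradient_step_decrease hf hL hLip (ha.le.trans (hηlow k hk)) (hηup k hk) (x k)
    rw [← hstep k hk] at h
    linarith
  set w : ℕ → ℝ := fun k => f (x k) - f xt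
  change ∀ k, N₁ ≤ k → 0 < w k at hw
  change ∀ k, N₁ ≤ k → 2 * μ * w k ^ α ≤ _ at hKL
  change ∀ k, N₁ ≤ k → _ ≤ w k - w (k + 1) at hdecr
  have hvalue (k : ℕ) (hk : N₁ ≤ k) :
      w N₁ ^ (1 - α) + (α - 1) * ((k : ℝ) - N₁) * (a * μ) ≤ w k ^ (1 - α) := by
    induction k, hk using Nat.le_induction with
    | base => simp
    | succ k hk ih =>
      have htan := rpow_neg_tangent_le (sub_nonneg.2 hα₁.le) (hw k hk)
        (hw (k + 1) (hk.trans k.le_succ))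
      rw [show -(α - 1) = 1 - α by ring, show 1 - α - 1 = -α by ring] at htan
      have hgap : a * μ * w k ^ α ≤ w k - w (k + 1) := by
        have := mul_le_mul (hηlow k hk) (hKL k hk)
          (by have := Real.rpow_pos_of_pos (hw k hk) α; positivity)
          (ha.le.trans (hηlow k hk))
        linarith [hdecr k hk]
      have hgap' : a * μ ≤ w k ^ (-α) * (w k - w (k + 1)) := by
        rw [Real.rpow_neg (hw k hk).le, ← div_eq_inv_mul,
          le_div_iff₀ (Real.rpow_pos_of_pos (hw k hk) α)]
        exact hgap
      have := mul_le_mul_of_nonneg_left hgap' (sub_nonneg.2 hα₁.le)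
      push_cast
      linarith
  set C := Real.sqrt (2 / μ) * (2 / (2 - α)) with hC
  have hC0 : 0 ≤ C := mul_nonneg (Real.sqrt_nonneg _) (div_nonneg zero_le_two (by linarith))
  have hlength (k : ℕ) (hk : N₁ ≤ k) :
      ‖x k - x (k + 1)‖ ≤ C * (w k ^ (1 - α / 2) - w (k + 1) ^ (1 - α / 2)) := by
    have hη0 : 0 ≤ η k := ha.le.trans (hηlow k hk)
    have htan := rpow_tangent_le (s := 1 - α / 2) (by linarith) (by linarith) (hw k hk)
      (hw (k + 1) (hk.trans k.le_succ)).le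
    rw [show 1 - α / 2 - 1 = -(α / 2) by ring] at htan
    have hnorm : ‖x k - x (k + 1)‖ = η k * ‖gradient f (x k)‖ := by
      rw [hstep k hk, sub_sub_cancel, norm_smul, Real.norm_of_nonneg hη0]
    have hpos := Real.rpow_pos_of_pos (hw k hk) (α / 2)
    have hsqrtμ := Real.sqrt_pos.2 (show 0 < 2 / μ by positivity)
    have hgrad : 2 * w k ^ (α / 2) ≤ Real.sqrt (2 / μ) * ‖gradient f (x k)‖ := by
      refine le_of_sq_le_sq ?_ (by positivity)
      rw [mul_pow, mul_pow, Real.sq_sqrt (by positivity), ← Real.rpow_mul_natCast (hw k hk).le]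
      have := mul_le_mul_of_nonneg_left (hKL k hk) (show 0 ≤ 2 / μ by positivity)
      calc _ = 2 / μ * (2 * μ * w k ^ α) := by
            rw [show α / 2 * ((2 : ℕ) : ℝ) = α by push_cast; ring]; field_simp
        _ ≤ _ := this
    have hstep_le : η k * ‖gradient f (x k)‖
        ≤ Real.sqrt (2 / μ) * (w k ^ (-(α / 2)) * (w k - w (k + 1))) := by
      rw [Real.rpow_neg (hw k hk).le, ← div_eq_inv_mul, ← mul_div_assoc, le_div_iff₀ hpos]
      have h₁ := mul_le_mul_of_nonneg_left hgrad
        (mul_nonneg hη0 (norm_nonneg (gradient f (x k))))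
      have h₂ := mul_le_mul_of_nonneg_left (hdecr k hk) hsqrtμ.le
      nlinarith
    rw [hnorm]
    refine hstep_le.trans ?_
    rw [hC, mul_assoc]
    refine mul_le_mul_of_nonneg_left ?_ hsqrtμ.le
    rw [div_mul_eq_mul_div, le_div_iff₀ (by linarith)]
    linarith
  have hdist (k : ℕ) (hk : N₁ ≤ k) (n : ℕ) (hn : k ≤ n) :
      ‖x k - x n‖ ≤ C * (w k ^ (1 - α / 2) - w n ^ (1 - α / 2)) := by
    induction n, hn using Nat.le_induction with
    | base => simp
    | succ n hn ih =>
      linarith [norm_sub_le_norm_sub_add_norm_sub (x k) (x n) (x (n + 1)),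
        hlength n (hk.trans hn)]
  intro k hk
  have hbound : ‖x k - xt‖ ≤ C * w k ^ (1 - α / 2) := by
    refine le_of_tendsto (tendsto_const_nhds.sub hlim).norm ?_
    filter_upwards [Filter.eventually_ge_atTop k] with n hn
    have := mul_nonneg hC0 (Real.rpow_nonneg (hw n (hk.trans hn)).le (1 - α / 2))
    linarith [hdist k hk n hn]
  refine hbound.trans (mul_le_mul_of_nonneg_left ?_ hC0)
  have hbase : 0 < w N₁ ^ (1 - α) + (α - 1) * ((k : ℝ) - N₁) * (a * μ) := by
    have hkN : (0 : ℝ) ≤ k - N₁ := sub_nonneg.2 (Nat.cast_le.2 hk)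
    have := Real.rpow_pos_of_pos (hw N₁ le_rfl) (1 - α)
    have := mul_nonneg (mul_nonneg (sub_nonneg.2 hα₁.le) hkN) (mul_pos ha hμ).le
    linarith
  have hexponent : 1 - α / 2 = (1 - α) * (-(2 - α) / (2 * (α - 1))) := by
    have : α - 1 ≠ 0 := by linarith
    field_simp
    ring
  rw [hexponent, Real.rpow_mul (hw k hk).le]
  exact Real.rpow_le_rpow_of_nonpos hbase (hvalue k hk)
    (div_nonpos_of_nonpos_of_nonneg (by linarith) (by linarith))
end
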